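/- arXiv:1810.08278 — 2 statements merged into one kernel-verified Lean document; each statement's English description precedes it below -/
import Mathlib

section
/- Let α and β be Borel probability measures on X, and assume the Gibbs kernel k_ε is strictly positive definite. Then S_ε(α, β) = 0 if and only if α = β. -/
open MeasureTheory Real Filter Topology
open scoped NNReal ENNReal

/-- The entropic dual functional `D_ε(α, β; f, g)`. -/
noncomputable def Dfun {X : Type*} [MeasurableSpace X] (eps : ℝ) (C : X → X → ℝ)
    (alpha beta : Measure X) (f g : X → ℝ) : ℝ :=
  (∫ x, f x ∂alpha) + (∫ y, g y ∂beta) -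
    eps * ∫ x, ∫ y, (Real.exp ((f x + g y - C x y) / eps) - 1) ∂beta ∂alpha

/-- The entropic transport cost `OT_ε(α, β)`, as a supremum of the dual
functional over pairs of continuous potentials. -/
noncomputable def OTcost {X : Type*} [TopologicalSpace X] [MeasurableSpace X] (eps : ℝ) (C : X → X → ℝ)
    (alpha beta : Measure X) : ℝ :=
  sSup {r : ℝ | ∃ f g : X → ℝ, Continuous f ∧ Continuous g ∧ r = Dfun eps C alpha beta f g}

/-- The Sinkhorn divergence `S_ε(α, β)`. -/
noncomputable def Sinkhorn {X : Type*} [TopologicalSpace X] [MeasurableSpace X] (eps : ℝ) (C : X → X → ℝ)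
    (alpha beta : Measure X) : ℝ :=
  OTcost eps C alpha beta - (1/2) * OTcost eps C alpha alpha - (1/2) * OTcost eps C beta beta

/-- The squared kernel norm `‖ξ‖²_k = ∫∫ k dξ dξ` of the finite signed measure
`ξ = μ - ν`, written out in terms of its positive and negative parts. -/
noncomputable def kerQuad {X : Type*} [MeasurableSpace X] (k : X → X → ℝ)
    (mu nu : Measure X) : ℝ :=
  ∫ x, ∫ y, k x y ∂mu ∂mu - ∫ x, ∫ y, k x y ∂nu ∂mu
    - ∫ x, ∫ y, k x y ∂mu ∂nu + ∫ x, ∫ y, k x y ∂nu ∂nu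

/-- A kernel is strictly positive definite if `‖ξ‖²_k > 0` for every nonzero
finite signed Borel measure `ξ = μ - ν`. -/
def StrictPosDef {X : Type*} [MeasurableSpace X] (k : X → X → ℝ) : Prop :=
  ∀ mu nu : Measure X, IsFiniteMeasure mu → IsFiniteMeasure nu → mu ≠ nu →
    0 < kerQuad k mu nu
open scoped BoundedContinuousFunction

section EntropicPotentials

variable {X : Type*} [MetricSpace X] [CompactSpace X] [MeasurableSpace X] [BorelSpace X]

/-- Continuous functions on a compact space are integrable for finite measures. -/
theorem Continuous.integrable_of_compactSpace {Y : Type*} [TopologicalSpace Y] [CompactSpace Y]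
    [MeasurableSpace Y] [OpensMeasurableSpace Y] {mu : Measure Y} [IsFiniteMeasure mu]
    {f : Y → ℝ} (hf : Continuous f) : Integrable f mu :=
  hf.integrable_of_hasCompactSupport (HasCompactSupport.of_compactSpace f)

theorem log_integral_exp_le (mu : Measure X) [IsProbabilityMeasure mu] {f g : X → ℝ}
    (hf : Continuous f) (hg : Continuous g) {δ : ℝ} (h : ∀ y, f y ≤ g y + δ) :
    log (∫ y, exp (f y) ∂mu) ≤ log (∫ y, exp (g y) ∂mu) + δ := by
  have hfi : Integrable (fun y => exp (f y)) mu :=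
    Continuous.integrable_of_compactSpace (by fun_prop)
  have hgi : Integrable (fun y => exp (g y)) mu :=
    Continuous.integrable_of_compactSpace (by fun_prop)
  conv_rhs => rw [← log_exp δ, ← log_mul (integral_exp_pos hgi).ne' (exp_pos _).ne']
  refine log_le_log (integral_exp_pos hfi) ?_
  rw [← integral_mul_const]
  refine integral_mono hfi (hgi.mul_const _) fun y => ?_
  simpa only [← exp_add] using exp_le_exp.2 (h y)

omit [MetricSpace X] [CompactSpace X] [BorelSpace X] in
theorem log_integral_exp_const (mu : Measure X) [IsProbabilityMeasure mu] (a : ℝ) :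
    log (∫ _, exp a ∂mu) = a := by
  simp

/-- The (rescaled) Sinkhorn map `φ ↦ - log ∫ exp (φ y - c x y) dμ(y)`. -/
noncomputable def sinkhornMap (mu : Measure X) (c : X → X → ℝ) (φ : X → ℝ) (x : X) : ℝ :=
  -log (∫ y, exp (φ y - c x y) ∂mu)

theorem sinkhornMap_le_add (mu : Measure X) [IsProbabilityMeasure mu] {c : X → X → ℝ}
    (hc : Continuous fun p : X × X => c p.1 p.2) {φ ψ : X → ℝ} (hφ : Continuous φ)
    (hψ : Continuous ψ) {x x' : X} {δ : ℝ} (h : ∀ y, ψ y - c x' y ≤ φ y - c x y + δ) :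
    sinkhornMap mu c φ x ≤ sinkhornMap mu c ψ x' + δ := by
  have h1 : ∀ z, Continuous fun y => c z y := fun z => hc.comp (by fun_prop : Continuous fun y => (z, y))
  have := log_integral_exp_le mu (hψ.sub (h1 x')) (hφ.sub (h1 x)) h
  simp only [sinkhornMap, Pi.sub_apply] at this ⊢
  linarith

theorem abs_sinkhornMap_add_le (mu : Measure X) [IsProbabilityMeasure mu] {c : X → X → ℝ}
    (hc : Continuous fun p : X × X => c p.1 p.2) {φ : X → ℝ} (hφ : Continuous φ)
    {M R : ℝ} (hM : ∀ x y, |c x y| ≤ M) (hR : ∀ x y, |φ x - φ y| ≤ R) (x : X) :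
    |sinkhornMap mu c φ x + φ x| ≤ R + M := by
  have h1 : Continuous fun y => φ y - c x y :=
    hφ.sub (hc.comp (by fun_prop : Continuous fun y => (x, y)))
  have h2 := log_integral_exp_le mu h1 (continuous_const (y := φ x)) (δ := R + M) fun y => by
    linarith [abs_le.1 (hM x y), abs_le.1 (hR x y)]
  have h3 := log_integral_exp_le mu (continuous_const (y := φ x)) h1 (δ := R + M) fun y => by
    linarith [abs_le.1 (hM x y), abs_le.1 (hR x y)]
  rw [log_integral_exp_const] at h2 h3
  simp only [sinkhornMap]
  rw [abs_le]
  constructor <;> linarith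

/-- The Sinkhorn map of a Lipschitz cost has a continuous fixed point. -/
theorem exists_sinkhornMap_fixedPoint (mu : Measure X) [IsProbabilityMeasure mu] {c : X → X → ℝ}
    {L : ℝ≥0} (hc : Continuous fun p : X × X => c p.1 p.2)
    (hL : ∀ y, LipschitzWith L fun x => c x y) :
    ∃ φ : X → ℝ, Continuous φ ∧ ∀ x, sinkhornMap mu c φ x = φ x := by
  have hLip : ∀ φ : X → ℝ, Continuous φ → LipschitzWith L (sinkhornMap mu c φ) := by
    intro φ hφ
    refine LipschitzWith.of_le_add_mul L fun x x' => ?_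
    refine sinkhornMap_le_add mu hc hφ hφ fun y => ?_
    have := (hL y).dist_le_mul x x'
    rw [Real.dist_eq] at this
    linarith [abs_le.1 this]
  obtain ⟨M, hM⟩ : ∃ M, ∀ x y, |c x y| ≤ M := by
    obtain ⟨M, hM⟩ := isCompact_univ.exists_bound_of_continuousOn hc.continuousOn
    exact ⟨M, fun x y => hM (x, y) trivial⟩
  set R : ℝ := L * Metric.diam (Set.univ : Set X)
  have hosc : ∀ φ : X → ℝ, LipschitzWith L φ → ∀ x y, |φ x - φ y| ≤ R := by
    intro φ hφ x y
    refine (hφ.dist_le_mul x y).trans ?_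
    exact mul_le_mul_of_nonneg_left
      (Metric.dist_le_diam_of_mem isCompact_univ.isBounded trivial trivial) L.2
  obtain ⟨x₀⟩ : Nonempty X := mu.nonempty_of_neZero
  have hB0 : 0 ≤ R + M := (abs_nonneg _).trans
    (abs_sinkhornMap_add_le mu hc (continuous_const (y := (0 : ℝ))) (R := R) hM
      (hosc _ (LipschitzWith.const' 0)) x₀)
  set B : ℝ := R + M
  let T : (X →ᵇ ℝ) → (X →ᵇ ℝ) := fun φ =>
    BoundedContinuousFunction.mkOfCompact ⟨sinkhornMap mu c φ, (hLip φ φ.continuous).continuous⟩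
  have hT : ∀ φ x, T φ x = sinkhornMap mu c φ x := fun _ _ => rfl
  have hTdist : ∀ φ ψ, dist (T φ) (T ψ) ≤ dist φ ψ := by
    intro φ ψ
    refine (BoundedContinuousFunction.dist_le dist_nonneg).2 fun x => ?_
    have key : ∀ y, |φ y - ψ y| ≤ dist φ ψ := fun y => by
      simpa only [Real.dist_eq] using
        BoundedContinuousFunction.dist_coe_le_dist (f := φ) (g := ψ) y
    have h1 := sinkhornMap_le_add mu hc φ.continuous ψ.continuous (x := x) (x' := x)
      (δ := dist φ ψ) fun y => by linarith [abs_le.1 (key y)]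
    have h2 := sinkhornMap_le_add mu hc ψ.continuous φ.continuous (x := x) (x' := x)
      (δ := dist φ ψ) fun y => by linarith [abs_le.1 (key y)]
    rw [Real.dist_eq, hT, hT, abs_le]
    constructor <;> linarith
  let K : Set (X →ᵇ ℝ) := {φ | LipschitzWith L φ ∧ ∀ x, |φ x| ≤ B}
  have hKclosed : IsClosed K := by
    have h : K = (⋂ x, ⋂ y, {φ : X →ᵇ ℝ | dist (φ x) (φ y) ≤ L * dist x y}) ∩
        ⋂ x, {φ : X →ᵇ ℝ | |φ x| ≤ B} := by
      ext φ
      simp [K, lipschitzWith_iff_dist_le_mul]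
    rw [h]
    have hev : ∀ x, Continuous fun φ : X →ᵇ ℝ => φ x := fun x =>
      continuous_eval_const x
    refine (isClosed_iInter fun x => isClosed_iInter fun y => ?_).inter
      (isClosed_iInter fun x => ?_)
    · exact isClosed_le ((hev x).dist (hev y)) continuous_const
    · exact isClosed_le (hev x).abs continuous_const
  have hKcompact : IsCompact K := by
    refine BoundedContinuousFunction.arzela_ascoli₂ (Set.Icc (-B) B) isCompact_Icc K hKclosed
      (fun φ x hφ => abs_le.1 (hφ.2 x)) ?_
    exact (LipschitzWith.uniformEquicontinuous _ L fun φ : K => φ.2.1).equicontinuous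
  have happrox : ∀ s : ℝ≥0, s < 1 → ∃ φ ∈ K, dist (T φ) φ ≤ (1 - s) * (2 * B) := by
    intro s hs
    have hcon : ContractingWith s fun φ => (s : ℝ) • T φ := by
      refine ⟨hs, LipschitzWith.of_dist_le_mul fun φ ψ => ?_⟩
      refine (dist_smul_le (s : ℝ) (T φ) (T ψ)).trans ?_
      rw [Real.norm_of_nonneg s.coe_nonneg]
      exact mul_le_mul_of_nonneg_left (hTdist φ ψ) s.2
    obtain ⟨φ, hfix⟩ : ∃ φ : X →ᵇ ℝ, (s : ℝ) • T φ = φ :=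
      ⟨_, ContractingWith.fixedPoint_isFixedPt hcon⟩
    have hφ : ∀ x, φ x = s * sinkhornMap mu c φ x := fun x =>
      (DFunLike.congr_fun hfix x).symm
    have hs1 : (s : ℝ) < 1 := by exact_mod_cast hs
    have hs0 : (0 : ℝ) ≤ s := s.2
    have hφL : LipschitzWith L φ := by
      refine LipschitzWith.of_dist_le_mul fun x y => ?_
      rw [hφ x, hφ y, Real.dist_eq, ← mul_sub, abs_mul, abs_of_nonneg hs0]
      have := (hLip φ φ.continuous).dist_le_mul x y
      rw [Real.dist_eq] at this
      nlinarith [abs_nonneg (sinkhornMap mu c φ x - sinkhornMap mu c φ y)]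
    have hsum := abs_sinkhornMap_add_le mu hc φ.continuous hM (hosc φ hφL)
    have hφB : ∀ x, |φ x| ≤ B := by
      intro x
      have h1 := abs_le.1 (hsum x)
      have h2 : φ x * (1 + s) = s * (sinkhornMap mu c φ x + φ x) := by linarith [hφ x]
      rw [abs_le]
      constructor <;> nlinarith
    refine ⟨φ, ⟨hφL, hφB⟩, ?_⟩
    refine (BoundedContinuousFunction.dist_le (by nlinarith)).2 fun x => ?_
    have h1 := abs_le.1 (hsum x)
    have h2 := abs_le.1 (hφB x)
    have h3 : T φ x - φ x = (1 - s) * T φ x := by rw [hT]; linarith [hφ x]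
    rw [Real.dist_eq, h3, abs_mul, abs_of_pos (by linarith)]
    refine mul_le_mul_of_nonneg_left ?_ (by linarith)
    rw [hT, abs_le]
    constructor <;> linarith
  have hTcont : Continuous T :=
    (LipschitzWith.of_dist_le_mul (K := 1) fun φ ψ => by simpa using hTdist φ ψ).continuous
  obtain ⟨φ₀, hφ₀K, -⟩ := happrox 0 zero_lt_one
  obtain ⟨φ, -, hmin⟩ := hKcompact.exists_isMinOn ⟨φ₀, hφ₀K⟩
    (hTcont.dist continuous_id).continuousOn
  have hzero : dist (T φ) φ ≤ 0 := by
    refine le_of_forall_pos_le_add fun η hη => ?_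
    have hpos : 0 < 2 * B + η + 1 := by linarith
    obtain ⟨s, hs, hsη⟩ : ∃ s : ℝ≥0, s < 1 ∧ (1 - (s : ℝ)) * (2 * B) ≤ η := by
      have hq : η / (2 * B + η + 1) ≤ 1 := (div_le_one hpos).2 (by linarith)
      have hq0 : 0 < η / (2 * B + η + 1) := div_pos hη hpos
      have hcoe := Real.coe_toNNReal (1 - η / (2 * B + η + 1)) (by linarith)
      refine ⟨Real.toNNReal (1 - η / (2 * B + η + 1)), ?_, ?_⟩
      · rw [← NNReal.coe_lt_coe, hcoe, NNReal.coe_one]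
        linarith
      · rw [hcoe, sub_sub_cancel, div_mul_eq_mul_div, div_le_iff₀ hpos]
        nlinarith
    obtain ⟨ψ, hψ, hψd⟩ := happrox s hs
    have := isMinOn_iff.1 hmin ψ hψ
    simp only [id] at this
    linarith
  refine ⟨φ, φ.continuous, fun x => ?_⟩
  rw [← hT, dist_le_zero.1 hzero]

theorem integral_exp_eq_one_of_fixedPoint (mu : Measure X) [IsProbabilityMeasure mu]
    {c : X → X → ℝ} (hc : Continuous fun p : X × X => c p.1 p.2) {φ : X → ℝ} (hφ : Continuous φ)
    (hfix : ∀ x, sinkhornMap mu c φ x = φ x) (x : X) :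
    ∫ y, exp (φ x + φ y - c x y) ∂mu = 1 := by
  have hcont : Continuous fun y => φ y - c x y :=
    hφ.sub (hc.comp (by fun_prop : Continuous fun y => (x, y)))
  have hpos : 0 < ∫ y, exp (φ y - c x y) ∂mu :=
    integral_exp_pos (Continuous.integrable_of_compactSpace (by fun_prop))
  have hexp : exp (φ x) = (∫ y, exp (φ y - c x y) ∂mu)⁻¹ := by
    rw [← hfix x, sinkhornMap, exp_neg, exp_log hpos]
  simp_rw [add_sub_assoc, exp_add]
  rw [integral_const_mul, hexp, inv_mul_cancel₀ hpos.ne']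

theorem Dfun_eq_integral_prod (eps : ℝ) {C : X → X → ℝ}
    (hC : Continuous fun p : X × X => C p.1 p.2) (alpha beta : Measure X)
    [IsProbabilityMeasure alpha] [IsProbabilityMeasure beta] {f g : X → ℝ}
    (hf : Continuous f) (hg : Continuous g) :
    Dfun eps C alpha beta f g = (∫ x, f x ∂alpha) + (∫ y, g y ∂beta) -
      eps * (∫ p, exp ((f p.1 + g p.2 - C p.1 p.2) / eps) ∂(alpha.prod beta) - 1) := by
  have hi : Integrable (fun p : X × X => exp ((f p.1 + g p.2 - C p.1 p.2) / eps))
      (alpha.prod beta) := Continuous.integrable_of_compactSpace (by fun_prop)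
  rw [Dfun, integral_integral (f := fun x y => exp ((f x + g y - C x y) / eps) - 1)
    (hi.sub (integrable_const 1)), integral_sub hi (integrable_const 1)]
  simp

theorem integral_prod_fst_add_snd (alpha beta : Measure X)
    [IsProbabilityMeasure alpha] [IsProbabilityMeasure beta] {f g : X → ℝ}
    (hf : Continuous f) (hg : Continuous g) :
    ∫ p, (f p.1 + g p.2) ∂(alpha.prod beta) = (∫ x, f x ∂alpha) + ∫ y, g y ∂beta := by
  rw [integral_add (Continuous.integrable_of_compactSpace (by fun_prop))
    (Continuous.integrable_of_compactSpace (by fun_prop)), integral_fun_fst, integral_fun_snd]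
  simp

theorem bddAbove_Dfun {eps : ℝ} (heps : 0 < eps) {C : X → X → ℝ}
    (hC : Continuous fun p : X × X => C p.1 p.2) (alpha beta : Measure X)
    [IsProbabilityMeasure alpha] [IsProbabilityMeasure beta] :
    BddAbove {r : ℝ | ∃ f g : X → ℝ, Continuous f ∧ Continuous g ∧
      r = Dfun eps C alpha beta f g} := by
  refine ⟨∫ p, C p.1 p.2 ∂(alpha.prod beta), ?_⟩
  rintro _ ⟨f, g, hf, hg, rfl⟩
  rw [Dfun_eq_integral_prod eps hC alpha beta hf hg, ← integral_prod_fst_add_snd alpha beta hf hg]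
  have hiC : Integrable (fun p : X × X => C p.1 p.2) (alpha.prod beta) :=
    Continuous.integrable_of_compactSpace hC
  have hifg : Integrable (fun p : X × X => f p.1 + g p.2) (alpha.prod beta) :=
    Continuous.integrable_of_compactSpace (by fun_prop)
  have h : ∫ p, ((f p.1 + g p.2 - C p.1 p.2) / eps + 1) ∂(alpha.prod beta) ≤
      ∫ p, exp ((f p.1 + g p.2 - C p.1 p.2) / eps) ∂(alpha.prod beta) :=
    integral_mono (Continuous.integrable_of_compactSpace (by fun_prop))
      (Continuous.integrable_of_compactSpace (by fun_prop)) fun p => add_one_le_exp _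
  rw [integral_add (Continuous.integrable_of_compactSpace (by fun_prop)) (integrable_const 1), integral_div,
    integral_sub hifg hiC] at h
  simp only [integral_const, probReal_univ, smul_eq_mul, mul_one] at h
  have h' := mul_le_mul_of_nonneg_left (le_sub_iff_add_le.2 h) heps.le
  rw [mul_div_cancel₀ _ heps.ne'] at h'
  linarith

theorem Dfun_le_OTcost {eps : ℝ} (heps : 0 < eps) {C : X → X → ℝ}
    (hC : Continuous fun p : X × X => C p.1 p.2) (alpha beta : Measure X)
    [IsProbabilityMeasure alpha] [IsProbabilityMeasure beta] {f g : X → ℝ}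
    (hf : Continuous f) (hg : Continuous g) :
    Dfun eps C alpha beta f g ≤ OTcost eps C alpha beta :=
  le_csSup (bddAbove_Dfun heps hC alpha beta) ⟨f, g, hf, hg, rfl⟩

/-- A symmetric pair of potentials with unit marginals bounds the self-transport cost. -/
theorem OTcost_self_le {eps : ℝ} (heps : 0 < eps) {C : X → X → ℝ}
    (hC : Continuous fun p : X × X => C p.1 p.2) (hCsym : ∀ x y, C x y = C y x)
    (mu : Measure X) [IsProbabilityMeasure mu] {φ : X → ℝ} (hφ : Continuous φ)
    (hone : ∀ x, ∫ y, exp (φ x + φ y - C x y / eps) ∂mu = 1) :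
    OTcost eps C mu mu ≤ 2 * (eps * ∫ x, φ x ∂mu) := by
  refine csSup_le ⟨_, 0, 0, continuous_const, continuous_const, rfl⟩ ?_
  rintro _ ⟨f, g, hf, hg, rfl⟩
  rw [Dfun_eq_integral_prod eps hC mu mu hf hg]
  set w : X → X → ℝ := fun x y => exp (φ x + φ y - C x y / eps) with hw
  have hwc : Continuous fun p : X × X => w p.1 p.2 := by simp only [hw]; fun_prop
  have hwsymm : ∀ x y, w x y = w y x := fun x y => by
    simp only [hw]
    rw [hCsym x y, add_comm (φ x)]
  have hmarg : ∀ u : X → ℝ, Continuous u →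
      ∫ p, w p.1 p.2 * u p.1 ∂(mu.prod mu) = ∫ x, u x ∂mu := by
    intro u hu
    rw [integral_prod _ (Continuous.integrable_of_compactSpace (by fun_prop))]
    refine integral_congr_ae (Eventually.of_forall fun x => ?_)
    simp only [integral_mul_const]
    rw [hone x, one_mul]
  have hmarg' : ∀ u : X → ℝ, Continuous u →
      ∫ p, w p.1 p.2 * u p.2 ∂(mu.prod mu) = ∫ x, u x ∂mu := by
    intro u hu
    rw [← hmarg u hu, ← integral_prod_swap]
    refine integral_congr_ae (Eventually.of_forall fun p => ?_)
    simp only [Prod.fst_swap, Prod.snd_swap]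
    rw [hwsymm]
  have hp : Continuous fun x => f x / eps - φ x + 1 := by fun_prop
  have hq : Continuous fun x => g x / eps - φ x := by fun_prop
  have hif : Integrable f mu := Continuous.integrable_of_compactSpace hf
  have hig : Integrable g mu := Continuous.integrable_of_compactSpace hg
  have hiφ : Integrable φ mu := Continuous.integrable_of_compactSpace hφ
  have hle : ∫ p, (w p.1 p.2 * (f p.1 / eps - φ p.1 + 1) + w p.1 p.2 * (g p.2 / eps - φ p.2))
        ∂(mu.prod mu) ≤
      ∫ p, exp ((f p.1 + g p.2 - C p.1 p.2) / eps) ∂(mu.prod mu) := by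
    refine integral_mono (Continuous.integrable_of_compactSpace (by fun_prop))
      (Continuous.integrable_of_compactSpace (by fun_prop)) fun p => ?_
    have hsplit : (f p.1 + g p.2 - C p.1 p.2) / eps = (φ p.1 + φ p.2 - C p.1 p.2 / eps) +
        ((f p.1 / eps - φ p.1) + (g p.2 / eps - φ p.2)) := by ring
    simp only [hsplit, exp_add (φ p.1 + φ p.2 - C p.1 p.2 / eps), hw]
    rw [← mul_add]
    refine mul_le_mul_of_nonneg_left ?_ (exp_pos _).le
    linarith [add_one_le_exp ((f p.1 / eps - φ p.1) + (g p.2 / eps - φ p.2))]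
  rw [integral_add (Continuous.integrable_of_compactSpace (by fun_prop))
    (Continuous.integrable_of_compactSpace (by fun_prop)), hmarg _ hp, hmarg' _ hq,
    integral_add (Continuous.integrable_of_compactSpace (by fun_prop)) (integrable_const 1),
    integral_sub (hif.div_const eps) hiφ, integral_sub (hig.div_const eps) hiφ,
    integral_div, integral_div] at hle
  simp only [integral_const, probReal_univ, smul_eq_mul, mul_one] at hle
  have h := mul_le_mul_of_nonneg_left (sub_le_sub_right hle 1) heps.le
  have hsimp : eps * ((∫ x, f x ∂mu) / eps - ∫ x, φ x ∂mu + 1 +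
      ((∫ x, g x ∂mu) / eps - ∫ x, φ x ∂mu) - 1) =
      (∫ x, f x ∂mu) + (∫ x, g x ∂mu) - 2 * (eps * ∫ x, φ x ∂mu) := by
    field_simp
    ring
  linarith

/-- The measure `exp φ • mu`. -/
noncomputable def expMeasure (mu : Measure X) (φ : X → ℝ) : Measure X :=
  mu.withDensity fun x => ENNReal.ofReal (exp (φ x))

omit [CompactSpace X] in
theorem integral_expMeasure (mu : Measure X) {φ : X → ℝ} (hφ : Continuous φ) (h : X → ℝ) :
    ∫ x, h x ∂(expMeasure mu φ) = ∫ x, exp (φ x) * h x ∂mu := by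
  rw [expMeasure, integral_withDensity_eq_integral_toReal_smul (by fun_prop) (by simp)]
  simp only [ENNReal.toReal_ofReal (exp_pos _).le, smul_eq_mul]

omit [CompactSpace X] in
theorem expMeasure_expMeasure_neg (mu : Measure X) {φ : X → ℝ} (hφ : Continuous φ) :
    expMeasure (expMeasure mu φ) (fun x => -φ x) = mu := by
  rw [expMeasure, expMeasure, ← withDensity_mul _ (by fun_prop) (by fun_prop)]
  convert withDensity_one
  ext x
  rw [Pi.mul_apply, Pi.one_apply]
  rw [← ENNReal.ofReal_mul (exp_pos _).le, ← exp_add]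
  simp

instance isFiniteMeasure_expMeasure (mu : Measure X) [IsFiniteMeasure mu] (φ : C(X, ℝ)) :
    IsFiniteMeasure (expMeasure mu φ) :=
  isFiniteMeasure_withDensity_ofReal
    (Continuous.integrable_of_compactSpace (by fun_prop)).2

theorem integral_integral_expMeasure (mu nu : Measure X) [IsFiniteMeasure mu] [IsFiniteMeasure nu]
    {c : X → X → ℝ} (hc : Continuous fun p : X × X => c p.1 p.2) {φ ψ : X → ℝ}
    (hφ : Continuous φ) (hψ : Continuous ψ) :
    ∫ x, ∫ y, exp (-c x y) ∂(expMeasure nu ψ) ∂(expMeasure mu φ) =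
      ∫ p, exp (φ p.1 + ψ p.2 - c p.1 p.2) ∂(mu.prod nu) := by
  rw [integral_expMeasure mu hφ,
    integral_prod _ (Continuous.integrable_of_compactSpace (by fun_prop))]
  refine integral_congr_ae (Eventually.of_forall fun x => ?_)
  simp only [integral_expMeasure nu hψ, ← integral_const_mul]
  refine integral_congr_ae (Eventually.of_forall fun y => ?_)
  simp only [← exp_add]
  ring_nf

end EntropicPotentials

/-- If the Gibbs kernel `k_ε` is strictly positive definite, the
Sinkhorn divergence vanishes exactly on the diagonal: `S_ε(α, β) = 0 ↔ α = β`. -/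
theorem sinkhorn_eq_zero_iff
    {X : Type*} [MetricSpace X] [CompactSpace X] [MeasurableSpace X] [BorelSpace X]
    (eps : ℝ) (heps : 0 < eps) (C : X → X → ℝ) (kappa : ℝ≥0) (hkappa : 0 < kappa)
    (hCsym : ∀ x y, C x y = C y x)
    (hClip1 : ∀ y, LipschitzWith kappa (fun x => C x y))
    (hClip2 : ∀ x, LipschitzWith kappa (fun y => C x y))
    (hpd : StrictPosDef (fun x y => Real.exp (-(C x y) / eps)))
    (alpha beta : Measure X) [IsProbabilityMeasure alpha] [IsProbabilityMeasure beta] :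
    Sinkhorn eps C alpha beta = 0 ↔ alpha = beta := by
  constructor
  swap
  · rintro rfl
    simp only [Sinkhorn]
    ring
  intro hS
  have hC : Continuous fun p : X × X => C p.1 p.2 :=
    (LipschitzWith.uncurry hClip1 hClip2).continuous
  have hc : Continuous fun p : X × X => C p.1 p.2 / eps := by fun_prop
  have hL : ∀ y, LipschitzWith (kappa / eps.toNNReal) fun x => C x y / eps := by
    refine fun y => LipschitzWith.of_dist_le_mul fun x x' => ?_
    rw [Real.dist_eq, ← sub_div, abs_div, abs_of_pos heps, NNReal.coe_div,
      Real.coe_toNNReal _ heps.le, div_mul_eq_mul_div]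
    exact div_le_div_of_nonneg_right ((hClip1 y).dist_le_mul x x') heps.le
  have hpot : ∀ (mu : Measure X) [IsProbabilityMeasure mu], ∃ φ : C(X, ℝ),
      ∀ x, ∫ y, exp (φ x + φ y - C x y / eps) ∂mu = 1 := by
    intro mu _
    obtain ⟨φ, hφ, hfix⟩ := exists_sinkhornMap_fixedPoint mu hc hL
    exact ⟨⟨φ, hφ⟩, integral_exp_eq_one_of_fixedPoint mu hc hφ hfix⟩
  obtain ⟨φ, hφ⟩ := hpot alpha
  obtain ⟨ψ, hψ⟩ := hpot beta
  have hker : ∀ (mu : Measure X) [IsProbabilityMeasure mu] (u : C(X, ℝ)),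
      (∀ x, ∫ y, exp (u x + u y - C x y / eps) ∂mu = 1) →
      ∀ x, ∫ y, exp (-(C x y / eps)) ∂(expMeasure mu u) = exp (-u x) := by
    intro mu _ u hu x
    rw [integral_expMeasure mu u.continuous, ← mul_one (exp (-u x)), ← hu x, ← integral_const_mul]
    refine integral_congr_ae (Eventually.of_forall fun y => ?_)
    simp only [← exp_add]
    ring_nf
  have hself : ∀ (mu : Measure X) [IsProbabilityMeasure mu] (u : C(X, ℝ)),
      (∀ x, ∫ y, exp (u x + u y - C x y / eps) ∂mu = 1) →
      ∫ x, ∫ y, exp (-(C x y / eps)) ∂(expMeasure mu u) ∂(expMeasure mu u) = 1 := by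
    intro mu _ u hu
    simp only [hker mu u hu, integral_expMeasure mu u.continuous, ← exp_add]
    simp
  have hmeas : expMeasure alpha φ = expMeasure beta ψ := by
    by_contra hne
    have hpos := hpd _ _ inferInstance inferInstance hne
    simp only [kerQuad, neg_div] at hpos
    have hcross : ∫ x, ∫ y, exp (-(C x y / eps)) ∂(expMeasure alpha φ) ∂(expMeasure beta ψ) =
        ∫ x, ∫ y, exp (-(C x y / eps)) ∂(expMeasure beta ψ) ∂(expMeasure alpha φ) := by
      rw [integral_integral_swap (Continuous.integrable_of_compactSpace
        (by simp only [Function.uncurry_def]; fun_prop))]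
      simp only [hCsym]
    rw [hself alpha φ hφ, hself beta ψ hψ, hcross,
      integral_integral_expMeasure alpha beta hc φ.continuous ψ.continuous] at hpos
    have h1 := OTcost_self_le heps hC hCsym alpha φ.continuous hφ
    have h2 := OTcost_self_le heps hC hCsym beta ψ.continuous hψ
    have h3 := Dfun_le_OTcost heps hC alpha beta (f := fun x => eps * φ x)
      (g := fun x => eps * ψ x) (by fun_prop) (by fun_prop)
    rw [Dfun_eq_integral_prod eps hC alpha beta (by fun_prop) (by fun_prop)] at h3
    simp only [integral_const_mul, sub_div, add_div, mul_div_cancel_left₀ _ heps.ne'] at h3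
    simp only [Sinkhorn] at hS
    nlinarith
  have hpoteq : ∀ x, φ x = ψ x := by
    intro x
    have h := hker alpha φ hφ x
    rw [hmeas, hker beta ψ hψ x, exp_eq_exp] at h
    linarith
  rw [← expMeasure_expMeasure_neg alpha φ.continuous, hmeas]
  simp only [hpoteq]
  exact expMeasure_expMeasure_neg beta ψ.continuous
end

section
/- For every Borel probability measure α on X and every continuous function f : X → ℝ, the function T_ε(α, f) is κ-Lipschitz on X, i.e. |T_ε(α, f)(y) − T_ε(α, f)(y')| ≤ κ d(y, y') for all y, y' ∈ X. -/
open MeasureTheory Real Filter Topology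
open scoped NNReal ENNReal

/-- The Sinkhorn map `T_ε(α, f)(y) = -ε log ∫ exp((f(x) - C(x,y))/ε) dα(x)`. -/
noncomputable def Tmap {X : Type*} [MeasurableSpace X] (eps : ℝ) (C : X → X → ℝ)
    (alpha : Measure X) (f : X → ℝ) : X → ℝ :=
  fun y => -eps * Real.log (∫ x, Real.exp ((f x - C x y) / eps) ∂alpha)

/-- The Gibbs kernel `exp ((f - c) / ε)` of continuous functions on a compact space is integrable
against every finite measure. -/
lemma integrable_exp_sub_div {X : Type*} [TopologicalSpace X] [CompactSpace X]
    [MeasurableSpace X] [OpensMeasurableSpace X] {alpha : Measure X} [IsFiniteMeasure alpha]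
    (eps : ℝ) {f c : X → ℝ} (hc : Continuous c) (hf : Continuous f) :
    Integrable (fun x => Real.exp ((f x - c x) / eps)) alpha := by
  have h : Continuous fun x => Real.exp ((f x - c x) / eps) := by fun_prop
  exact h.integrable_of_hasCompactSupport (HasCompactSupport.of_compactSpace _)

/-- The Sinkhorn map produces `κ`-Lipschitz potentials:
`|T_ε(α, f)(y) - T_ε(α, f)(y')| ≤ κ d(y, y')`. -/
theorem Tmap_lipschitz
    {X : Type*} [MetricSpace X] [CompactSpace X] [MeasurableSpace X] [BorelSpace X]
    (eps : ℝ) (heps : 0 < eps) (C : X → X → ℝ) (kappa : ℝ≥0) (hkappa : 0 < kappa)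
    (hCsym : ∀ x y, C x y = C y x)
    (hClip1 : ∀ y, LipschitzWith kappa (fun x => C x y))
    (hClip2 : ∀ x, LipschitzWith kappa (fun y => C x y))
    (alpha : Measure X) [IsProbabilityMeasure alpha]
    (f : X → ℝ) (hf : Continuous f) :
    LipschitzWith kappa (Tmap eps C alpha f) := by
  refine LipschitzWith.of_le_add_mul kappa fun y z => ?_
  have hint : ∀ w, Integrable (fun x => Real.exp ((f x - C x w) / eps)) alpha := fun w =>
    (integrable_exp_sub_div eps (hClip1 w).continuous hf)
  have hpos : ∀ w, 0 < ∫ x, Real.exp ((f x - C x w) / eps) ∂alpha := fun w =>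
    integral_exp_pos (hint w)
  have hle : ∫ x, Real.exp ((f x - C x z) / eps) ∂alpha ≤
      Real.exp (kappa * dist y z / eps) * ∫ x, Real.exp ((f x - C x y) / eps) ∂alpha := by
    rw [← integral_const_mul]
    refine integral_mono (hint z) ((hint y).const_mul _) fun x => ?_
    simp only [← Real.exp_add, ← add_div]
    gcongr
    linarith [(hClip2 x).le_add_mul y z]
  have hlog := Real.log_le_log (hpos z) hle
  rw [Real.log_mul (Real.exp_ne_zero _) (hpos y).ne', Real.log_exp] at hlog
  have hmul := mul_le_mul_of_nonneg_left hlog heps.le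
  rw [mul_add, mul_div_cancel₀ _ heps.ne'] at hmul
  simp only [Tmap]
  linarith
end
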